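/- For n ≥ 2 and integers p, q with 1 ≤ p, 2 ≤ q, q ≥ p+n, q+n-1 ≤ 3n-2, the signature of the permutation of {1,…,3n-2} given by the concatenated sequence X_1 X_2 X_3 with X_1 = (2,…,p, p+n,…,q-1, q+n,…,3n-2), X_2 = (1, p+1,…,p+n-1), X_3 = (q,…,q+n-1), equals (-1)^{(q+p+1)n+p+1}. -/

import Mathlib

/-- The sign of a permutation of `Fin N` as a product over pairs of natural numbers. -/
theorem sign_eq_prod_range_prod_range {N : ℕ} (σ : Equiv.Perm (Fin N)) (f : ℕ → ℕ)
    (hf : ∀ x : Fin N, (σ x : ℕ) = f x) :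
    Equiv.Perm.sign σ =
      ∏ j ∈ Finset.range N, ∏ i ∈ Finset.range j, if f i < f j then (1 : ℤˣ) else -1 := by
  rw [Equiv.Perm.sign_eq_prod_prod_Iio, Finset.prod_range]
  refine Finset.prod_congr rfl fun j _ => ?_
  refine Finset.prod_bij (fun i _ => (i : ℕ)) ?_ ?_ ?_ ?_
  · intro i hi
    simpa using hi
  · intro a _ b _ h
    exact Fin.ext h
  · intro b hb
    have hb' : b < j := by simpa using hb
    exact ⟨⟨b, hb'.trans j.isLt⟩, by simpa [Fin.lt_def] using hb', rfl⟩
  · intro i _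
    simp only [Fin.lt_def, hf]

/-- If the inversions `(i, j)` with `i < j` are those with `i ∈ [a, b)`, they contribute
`(-1) ^ (b - a)` to the sign. -/
theorem prod_range_ite_lt_eq_neg_one_pow {f : ℕ → ℕ} {a b j : ℕ} (hb : b ≤ j)
    (h : ∀ i < j, f i < f j ↔ ¬ (a ≤ i ∧ i < b)) :
    (∏ i ∈ Finset.range j, if f i < f j then (1 : ℤˣ) else -1) = (-1) ^ (b - a) := by
  have h1 : ∀ i ∈ Finset.range j, (if f i < f j then (1 : ℤˣ) else -1) =
      if i ∈ Finset.Ico a b then -1 else 1 := by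
    intro i hi
    rw [Finset.mem_range] at hi
    by_cases hc : a ≤ i ∧ i < b <;> simp [h i hi, hc]
  have h2 : Finset.range j ∩ Finset.Ico a b = Finset.Ico a b := by
    ext i
    simp only [Finset.mem_inter, Finset.mem_range, Finset.mem_Ico]
    omega
  rw [Finset.prod_congr rfl h1, Finset.prod_ite_mem, h2, Finset.prod_const, Nat.card_Ico]

theorem stmt17 (n p q : ℕ) (hn : 2 ≤ n) (hp : 1 ≤ p) (hq2 : 2 ≤ q) (hpq : p + n ≤ q)
    (hq3 : q + n - 1 ≤ 3 * n - 2)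
    (σ : Equiv.Perm (Fin (3 * n - 2)))
    (hσ : ∀ x : Fin (3 * n - 2), (σ x : ℕ) + 1 =
      if (x : ℕ) + 1 ≤ p - 1 then (x : ℕ) + 2
      else if (x : ℕ) + 1 ≤ q - n - 1 then (x : ℕ) + 1 + n
      else if (x : ℕ) + 1 ≤ n - 2 then (x : ℕ) + 1 + 2 * n
      else if (x : ℕ) + 1 = n - 1 then 1
      else if (x : ℕ) + 1 ≤ 2 * n - 2 then (x : ℕ) + 2 + p - n
      else (x : ℕ) + q + 2 - 2 * n) :
    Equiv.Perm.sign σ = (-1 : ℤˣ) ^ ((q + p + 1) * n + p + 1) := by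
  obtain ⟨m, rfl⟩ : ∃ m, n = m + 2 := ⟨n - 2, by omega⟩
  obtain ⟨a, ha⟩ : ∃ a, m + 1 = p + a := ⟨m + 1 - p, by omega⟩
  obtain ⟨b, hb⟩ : ∃ b, 2 * m + 3 = q + b := ⟨2 * m + 3 - q, by omega⟩
  let f : ℕ → ℕ := fun x =>
    if x + 1 ≤ p - 1 then x + 1
    else if x + 1 ≤ q - (m + 2) - 1 then x + (m + 2)
    else if x + 1 ≤ m then x + 2 * (m + 2)
    else if x = m then 0
    else if x ≤ 2 * m + 1 then x + 1 + p - (m + 2)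
    else x + q + 1 - 2 * (m + 2)
  have hf : ∀ x : Fin (3 * (m + 2) - 2), (σ x : ℕ) = f x := by
    intro x
    have := hσ x
    simp only [f]
    split_ifs at this ⊢ <;> omega
  have hf_second : ∀ k < m + 1, f (m + 1 + k) = p + k := by
    intro k hk
    simp only [f]
    split_ifs <;> omega
  have hf_third : ∀ k, f (m + 1 + (m + 1) + k) = q + k - 1 := by
    intro k
    simp only [f]
    split_ifs <;> omega
  have hfirst : ∀ j ∈ Finset.range m,
      (∏ i ∈ Finset.range j, if f i < f j then (1 : ℤˣ) else -1) = 1 := by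
    intro j hj
    rw [Finset.mem_range] at hj
    rw [prod_range_ite_lt_eq_neg_one_pow (a := 0) (b := 0) (Nat.zero_le j), Nat.sub_self, pow_zero]
    intro i hi
    simp only [f]
    split_ifs <;> omega
  have hone : (∏ i ∈ Finset.range m, if f i < f m then (1 : ℤˣ) else -1) = (-1) ^ m := by
    rw [prod_range_ite_lt_eq_neg_one_pow (a := 0) (b := m) le_rfl, Nat.sub_zero]
    intro i hi
    simp only [f]
    split_ifs <;> omega
  have hsecond : ∀ k ∈ Finset.range (m + 1), (∏ i ∈ Finset.range (m + 1 + k),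
      if f i < f (m + 1 + k) then (1 : ℤˣ) else -1) = (-1) ^ a := by
    intro k hk
    rw [Finset.mem_range] at hk
    rw [prod_range_ite_lt_eq_neg_one_pow (a := p - 1) (b := m) (by omega)]
    · congr 1
      omega
    · intro i hi
      rw [hf_second k hk]
      simp only [f]
      split_ifs <;> omega
  have hthird : ∀ k ∈ Finset.range (m + 2), (∏ i ∈ Finset.range (m + 1 + (m + 1) + k),
      if f i < f (m + 1 + (m + 1) + k) then (1 : ℤˣ) else -1) = (-1) ^ b := by
    intro k hk
    rw [Finset.mem_range] at hk
    rw [prod_range_ite_lt_eq_neg_one_pow (a := q - (m + 2) - 1) (b := m) (by omega)]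
    · congr 1
      omega
    · intro i hi
      rw [hf_third]
      simp only [f]
      split_ifs <;> omega
  rw [sign_eq_prod_range_prod_range σ f hf,
    show 3 * (m + 2) - 2 = m + 1 + (m + 1) + (m + 2) by omega,
    Finset.prod_range_add, Finset.prod_range_add, Finset.prod_range_succ,
    Finset.prod_congr rfl hfirst, hone, Finset.prod_congr rfl hsecond,
    Finset.prod_congr rfl hthird]
  simp only [Finset.prod_const, Finset.card_range, one_pow, one_mul, ← pow_mul, ← pow_add]
  apply neg_one_pow_congr
  have hma : Even (m + 1) ↔ Even (p + a) := by rw [ha]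
  have hqb : Even (2 * m + 3) ↔ Even (q + b) := by rw [hb]
  grind [Nat.even_add_one]
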